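/- arXiv:2501.04854 — 2 statements merged into one kernel-verified Lean document; each statement's English description precedes it below -/
import Mathlib

section
/- Action of the configuration adjacency operator on symmetric functions (Lemma 6.3): Let ℓ, n ∈ ℕ₊, let Ψ : Config_{n,ℓ} → ℝ, let ψ = Ψ ∘ config_{n,ℓ} : F_2^{ℓ×n} → ℝ, let g, h ∈ Config_{n,ℓ} and let Y ∈ F_2^{ℓ×n} with config_{n,ℓ}(Y) = g. Then (A_h ψ)(Y) = Σ_{F ∈ F_{g,h}} ( ∏_{w∈F_2^ℓ} g(w)! / ∏_{u∈F_2^ℓ} F(u,w)! ) · Ψ(g + Δ_F), where Δ_F(v) = Σ_{u∈F_2^ℓ} (F(u, u+v) − F(u,v)); here g + Δ_F is again an element of Config_{n,ℓ}. -/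
open scoped BigOperators

/-- The configuration of a matrix: `config X u` is the number of columns of `X` equal to `u`. -/
def config {ℓ n : ℕ}
    (X : Matrix (Fin ℓ) (Fin n) (ZMod 2)) (u : Fin ℓ → ZMod 2) : ℕ :=
  (Finset.univ.filter fun k : Fin n => ∀ i, X i k = u i).card

/-- `F_{g,h}`: functions `F : F_2^ℓ × F_2^ℓ → ℕ` with `Σ_u F(u,v) = g(v)` and `Σ_v F(u,v) = h(u)`. -/
def Fgh {ℓ : ℕ} (g h : (Fin ℓ → ZMod 2) → ℕ) :
    Set ((Fin ℓ → ZMod 2) → (Fin ℓ → ZMod 2) → ℕ) :=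
  {F | (∀ v, ∑ u, F u v = g v) ∧ ∀ u, ∑ v, F u v = h u}

/-- The adjacency operator `A_h`: `(A_h f)(y) = Σ_{x : config(x−y) = h} f(x)`. -/
def Aop {ℓ n : ℕ} (h : (Fin ℓ → ZMod 2) → ℕ)
    (f : Matrix (Fin ℓ) (Fin n) (ZMod 2) → ℝ) (y : Matrix (Fin ℓ) (Fin n) (ZMod 2)) : ℝ :=
  ∑ x ∈ Finset.univ.filter (fun x : Matrix (Fin ℓ) (Fin n) (ZMod 2) => config (x - y) = h), f x

open MvPolynomial in
lemma prod_univ_X_pow_eq_monomial {β : Type*} [Fintype β] (c : β → ℕ) :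
    ∏ b, (X b : MvPolynomial β ℕ) ^ c b = monomial (Finsupp.equivFunOnFinite.symm c) 1 := by
  rw [monic_monomial_eq, Finsupp.prod_fintype _ _ (by simp)]
  simp

open MvPolynomial in
/-- The number of functions with prescribed fibre sizes is a multinomial coefficient. -/
lemma card_fun_card_fiber_eq {α β : Type*} [Fintype α] [DecidableEq α] [Fintype β]
    [DecidableEq β] (c : β → ℕ) (hc : ∑ b, c b = Fintype.card α) :
    (Finset.univ.filter fun f : α → β =>
      ∀ b, (Finset.univ.filter fun a => f a = b).card = c b).card =
      Nat.multinomial Finset.univ c := by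
  have key : ∑ f : α → β, ∏ a, (X (f a) : MvPolynomial β ℕ) =
      (∑ b, X b) ^ Fintype.card α := by
    rw [← Fintype.prod_sum (fun (_ : α) (b : β) => (X b : MvPolynomial β ℕ))]
    simp
  have hfib (f : α → β) : ∏ a, (X (f a) : MvPolynomial β ℕ) =
      monomial (Finsupp.equivFunOnFinite.symm
        fun b => (Finset.univ.filter fun a => f a = b).card) 1 := by
    rw [← prod_univ_X_pow_eq_monomial, ← Finset.prod_fiberwise' Finset.univ f]
    simp
  rw [Finset.sum_pow_eq_sum_piAntidiag] at key
  have key := congrArg (coeff (Finsupp.equivFunOnFinite.symm c)) key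
  simp only [hfib, prod_univ_X_pow_eq_monomial, coeff_sum, ← C_eq_coe_nat, coeff_C_mul,
    coeff_monomial, EmbeddingLike.apply_eq_iff_eq, mul_ite, mul_one, mul_zero] at key
  rw [Finset.sum_ite_eq', if_pos (by simp [hc]), Finset.sum_boole] at key
  simpa [funext_iff] using key

/-- The number of functions with prescribed joint fibre sizes with respect to a given `y`. -/
lemma card_fun_card_joint_fiber_eq {ι β γ : Type*} [Fintype ι] [DecidableEq ι]
    [Fintype β] [DecidableEq β] [Fintype γ] [DecidableEq γ] (y : ι → γ) (F : β → γ → ℕ)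
    (hF : ∀ w, ∑ u, F u w = (Finset.univ.filter fun k => y k = w).card) :
    (Finset.univ.filter fun z : ι → β =>
      (fun u w => (Finset.univ.filter fun k => z k = u ∧ y k = w).card) = F).card =
      ∏ w, Nat.multinomial Finset.univ fun u => F u w := by
  have h1 (w : γ) := card_fun_card_fiber_eq (α := {k // y k = w}) (fun u => F u w)
    (by rw [hF, Fintype.card_subtype])
  simp_rw [← h1]
  rw [← Fintype.card_piFinset]
  refine Finset.card_equiv
    (((Equiv.sigmaFiberEquiv y).symm.arrowCongr (Equiv.refl β)).trans
      (Equiv.piCurry fun (_ : γ) _ => β)) fun z => ?_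
  have h2 (u : β) (w : γ) :
      (Finset.univ.filter fun k : {k // y k = w} => z k = u).card =
        (Finset.univ.filter fun k => z k = u ∧ y k = w).card := by
    rw [← Finset.card_map (Function.Embedding.subtype _)]
    congr 1
    ext k
    simp [and_comm]
  simp only [Finset.mem_filter, Finset.mem_univ, true_and, Fintype.mem_piFinset, funext_iff]
  rw [forall_comm]
  refine forall_congr' fun w => forall_congr' fun u => ?_
  rw [← h2]
  rfl

lemma config_eq_card {ℓ n : ℕ} (X : Matrix (Fin ℓ) (Fin n) (ZMod 2)) (u : Fin ℓ → ZMod 2) :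
    config X u = (Finset.univ.filter fun k => X.col k = u).card := by
  simp only [config, funext_iff, Matrix.col_apply]

/-- The joint configuration of two matrices. -/
def jointConfig {ℓ n : ℕ} (Z Y : Matrix (Fin ℓ) (Fin n) (ZMod 2)) (u w : Fin ℓ → ZMod 2) : ℕ :=
  (Finset.univ.filter fun k => Z.col k = u ∧ Y.col k = w).card

lemma sum_jointConfig_left {ℓ n : ℕ} (Z Y : Matrix (Fin ℓ) (Fin n) (ZMod 2))
    (w : Fin ℓ → ZMod 2) : ∑ u, jointConfig Z Y u w = config Y w := by
  rw [config_eq_card, Finset.card_eq_sum_card_fiberwise (f := Z.col) (t := Finset.univ) (by simp)]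
  simp only [jointConfig, Finset.filter_filter, and_comm]

lemma sum_jointConfig_right {ℓ n : ℕ} (Z Y : Matrix (Fin ℓ) (Fin n) (ZMod 2))
    (u : Fin ℓ → ZMod 2) : ∑ w, jointConfig Z Y u w = config Z u := by
  rw [config_eq_card, Finset.card_eq_sum_card_fiberwise (f := Y.col) (t := Finset.univ) (by simp)]
  simp only [jointConfig, Finset.filter_filter]

lemma config_eq_sum_jointConfig {ℓ n : ℕ} (X Y : Matrix (Fin ℓ) (Fin n) (ZMod 2))
    (v : Fin ℓ → ZMod 2) : config X v = ∑ u, jointConfig (X - Y) Y u (u + v) := by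
  rw [config_eq_card,
    Finset.card_eq_sum_card_fiberwise (f := (X - Y).col) (t := Finset.univ) (by simp)]
  refine Finset.sum_congr rfl fun u _ => ?_
  simp only [jointConfig, Finset.filter_filter]
  congr 1
  ext k
  simp only [Finset.mem_filter, Finset.mem_univ, true_and, funext_iff, Matrix.col_apply,
    Matrix.sub_apply, Pi.add_apply, ← forall_and]
  refine forall_congr' fun i => ?_
  generalize X i k = a
  generalize Y i k = b
  generalize u i = c
  generalize v i = d
  revert a b c d
  decide

lemma card_sub_jointConfig_eq {ℓ n : ℕ} (Y : Matrix (Fin ℓ) (Fin n) (ZMod 2))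
    (F : (Fin ℓ → ZMod 2) → (Fin ℓ → ZMod 2) → ℕ) (hF : ∀ w, ∑ u, F u w = config Y w) :
    (Finset.univ.filter fun X => jointConfig (X - Y) Y = F).card =
      ∏ w, Nat.multinomial Finset.univ fun u => F u w := by
  rw [← card_fun_card_joint_fiber_eq Y.col F fun w => (hF w).trans (config_eq_card Y w)]
  refine Finset.card_equiv ((Equiv.subRight Y).trans (Equiv.piComm _)) fun X => ?_
  simp only [Finset.mem_filter, Finset.mem_univ, true_and]
  rfl

lemma finite_Fgh {ℓ : ℕ} (g h : (Fin ℓ → ZMod 2) → ℕ) : (Fgh g h).Finite := by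
  refine (Set.finite_Icc 0 fun _ v => g v).subset fun F hF => ⟨fun _ _ => Nat.zero_le _, ?_⟩
  intro u v
  refine le_of_le_of_eq ?_ (hF.1 v)
  exact Finset.single_le_sum (f := fun u => F u v) (fun _ _ => Nat.zero_le _) (Finset.mem_univ u)


/-- **Action of the configuration adjacency operator on symmetric functions** (Lemma 6.3):
`(A_h ψ)(Y) = Σ_{F∈F_{g,h}} (∏_w g(w)!/∏_u F(u,w)!) · Ψ(g + Δ_F)` where
`(g + Δ_F)(v) = g(v) + Σ_u F(u,u+v) − Σ_u F(u,v)` (a configuration again). -/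
theorem Aop_on_symmetric (ℓ n : ℕ) (hℓ : 0 < ℓ) (hn : 0 < n)
    (Ψ : ((Fin ℓ → ZMod 2) → ℕ) → ℝ)
    (g h : (Fin ℓ → ZMod 2) → ℕ) (hgsum : ∑ u, g u = n) (hhsum : ∑ u, h u = n)
    (Y : Matrix (Fin ℓ) (Fin n) (ZMod 2)) (hY : config Y = g) :
    Aop h (fun X => Ψ (config X)) Y =
      ∑ᶠ Fc ∈ Fgh g h,
        ((∏ w, ((g w).factorial / ∏ u, (Fc u w).factorial) : ℕ) : ℝ) *
          Ψ (fun v => g v + ∑ u, Fc u (u + v) - ∑ u, Fc u v) := by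
  classical
  subst hY
  rw [finsum_mem_eq_finite_toFinset_sum _ (finite_Fgh _ _), Aop,
    ← Finset.sum_fiberwise_of_maps_to (g := fun X => jointConfig (X - Y) Y)
      (t := (finite_Fgh (config Y) h).toFinset)]
  · refine Finset.sum_congr rfl fun F hF => ?_
    obtain ⟨hF₁, hF₂⟩ := (Set.Finite.mem_toFinset _).1 hF
    have hfilter : ((Finset.univ.filter fun X => config (X - Y) = h).filter
        fun X => jointConfig (X - Y) Y = F) =
        Finset.univ.filter fun X => jointConfig (X - Y) Y = F := by
      rw [Finset.filter_filter]
      refine Finset.filter_congr fun X _ => and_iff_right_of_imp ?_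
      rintro rfl
      funext u
      rw [← hF₂, sum_jointConfig_right]
    rw [hfilter, Finset.sum_congr rfl (g := fun _ =>
      Ψ fun v => config Y v + ∑ u, F u (u + v) - ∑ u, F u v), Finset.sum_const,
      card_sub_jointConfig_eq Y F hF₁, nsmul_eq_mul]
    · simp only [Nat.multinomial, hF₁]
    · intro X hX
      obtain rfl := (Finset.mem_filter.1 hX).2
      congr 1
      funext v
      rw [hF₁, Nat.add_sub_cancel_left, config_eq_sum_jointConfig X Y]
  · intro X hX
    rw [Set.Finite.mem_toFinset]
    exact ⟨sum_jointConfig_left _ Y, fun u => by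
      rw [sum_jointConfig_right, (Finset.mem_filter.1 hX).2]⟩
end

section
/- Nonpositivity of Φ_m on nonzero balanced matrices (Lemma 6.4(iii)): Let ℓ, n ∈ ℕ₊, ε ∈ (0,1), and let m be an even natural number with m ≥ (ℓ−1)/lg(1/ε), where lg is the base-2 logarithm. Then for every X ∈ Valid^ε_{n,ℓ} with X ≠ 0, one has Φ_m(X) ≤ 0. -/
open scoped BigOperators

/-- Hamming weight of a vector over `F_2`. -/
def wt {n : ℕ} (x : Fin n → ZMod 2) : ℕ :=
  (Finset.univ.filter fun k => x k ≠ 0).card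

/-- The set `Valid^ε_{n,ℓ}` of `ε`-balanced matrices: every nonzero `F_2`-linear combination of
the rows has Hamming weight between `(1−ε)n/2` and `(1+ε)n/2`. -/
def ValidEps (ℓ n : ℕ) (ε : ℝ) : Set (Matrix (Fin ℓ) (Fin n) (ZMod 2)) :=
  {X | ∀ u : Fin ℓ → ZMod 2, Matrix.vecMul u X ≠ 0 →
    (1 - ε) * n / 2 ≤ (wt (Matrix.vecMul u X) : ℝ) ∧
      (wt (Matrix.vecMul u X) : ℝ) ≤ (1 + ε) * n / 2}

/-- `φ_{m,u}(X) = Σ_{v : ⟨u,v⟩=1} ((n − 2|vX|)^m − (εn)^m)`. -/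
noncomputable def phi (ℓ n : ℕ) (ε : ℝ) (m : ℕ) (u : Fin ℓ → ZMod 2)
    (X : Matrix (Fin ℓ) (Fin n) (ZMod 2)) : ℝ :=
  ∑ v ∈ Finset.univ.filter (fun v : Fin ℓ → ZMod 2 => ∑ j, u j * v j = 1),
    (((n : ℝ) - 2 * (wt (Matrix.vecMul v X) : ℝ)) ^ m - (ε * n) ^ m)

/-- `Φ_m = ∏_{u ≠ 0} φ_{m,u}`. -/
noncomputable def Phi (ℓ n : ℕ) (ε : ℝ) (m : ℕ)
    (X : Matrix (Fin ℓ) (Fin n) (ZMod 2)) : ℝ :=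
  ∏ u ∈ Finset.univ.filter (fun u : Fin ℓ → ZMod 2 => u ≠ 0), phi ℓ n ε m u X

/-- A set of vectors over `F_2` stable under adding a nonzero vector has even cardinality. -/
theorem even_card_of_add_mem {ℓ : ℕ} (S : Finset (Fin ℓ → ZMod 2)) {w : Fin ℓ → ZMod 2}
    (hw : w ≠ 0) (hS : ∀ u ∈ S, u + w ∈ S) : Even S.card := by
  have hsum : ∑ _u ∈ S, (1 : ZMod 2) = 0 :=
    Finset.sum_involution (fun u _ => u + w) (fun _ _ => by decide)
      (fun u _ _ h => hw (by simpa using h)) hS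
      (fun u _ => funext fun j => by
        simp [add_assoc, CharTwo.add_self_eq_zero])
  rw [even_iff_two_dvd, ← ZMod.natCast_eq_zero_iff]
  simpa using hsum

theorem prod_nonpos_of_odd_card {ι : Type*} {s : Finset ι} {f : ι → ℝ}
    (hs : Odd s.card) (hf : ∀ i ∈ s, f i ≤ 0) : ∏ i ∈ s, f i ≤ 0 := by
  have h : 0 ≤ ∏ i ∈ s, -f i := Finset.prod_nonneg fun i hi => neg_nonneg.2 (hf i hi)
  rw [Finset.prod_neg, hs.neg_one_pow] at h
  linarith

theorem wt_zero {n : ℕ} : wt (0 : Fin n → ZMod 2) = 0 := by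
  simp [wt]

theorem abs_sub_two_mul_wt_le {ℓ n : ℕ} {ε : ℝ} {X : Matrix (Fin ℓ) (Fin n) (ZMod 2)}
    (hX : X ∈ ValidEps ℓ n ε) {v : Fin ℓ → ZMod 2} (hv : Matrix.vecMul v X ≠ 0) :
    |(n : ℝ) - 2 * wt (Matrix.vecMul v X)| ≤ ε * n := by
  obtain ⟨h₁, h₂⟩ := hX v hv
  rw [abs_le]
  constructor <;> linarith

/-- `φ_{m,u}(X) ≤ 0` when `u` is orthogonal to the left kernel of `X`. -/
theorem phi_nonpos {ℓ n m : ℕ} {ε : ℝ} (hm : Even m)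
    {X : Matrix (Fin ℓ) (Fin n) (ZMod 2)} (hX : X ∈ ValidEps ℓ n ε) {u : Fin ℓ → ZMod 2}
    (hu : ∀ v, Matrix.vecMul v X = 0 → ∑ j, u j * v j = 0) : phi ℓ n ε m u X ≤ 0 := by
  refine Finset.sum_nonpos fun v hv => ?_
  have hv1 : ∑ j, u j * v j = 1 := (Finset.mem_filter.1 hv).2
  have hvX : Matrix.vecMul v X ≠ 0 := fun h => zero_ne_one ((hu v h).symm.trans hv1)
  rw [sub_nonpos, ← hm.pow_abs]
  exact pow_le_pow_left₀ (abs_nonneg _) (abs_sub_two_mul_wt_le hX hvX) m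

theorem two_mul_card_filter_eq_one {ℓ : ℕ} {u v : Fin ℓ → ZMod 2} (huv : ∑ j, u j * v j = 1) :
    2 * (Finset.univ.filter fun x : Fin ℓ → ZMod 2 => ∑ j, u j * x j = 1).card = 2 ^ ℓ := by
  have hcard : (Finset.univ.filter fun x : Fin ℓ → ZMod 2 => ∑ j, u j * x j = 1).card =
      (Finset.univ.filter fun x : Fin ℓ → ZMod 2 => ¬ ∑ j, u j * x j = 1).card := by
    have key : ∀ a : ZMod 2, ¬ a = 1 ↔ a + 1 = 1 := by decide
    refine Finset.card_equiv (Equiv.addRight v) fun x => ?_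
    simp only [Finset.mem_filter, Finset.mem_univ, true_and, Equiv.coe_addRight, Pi.add_apply,
      mul_add, Finset.sum_add_distrib, huv]
    rw [key, add_assoc, CharTwo.add_self_eq_zero, add_zero]
  have h := Finset.card_filter_add_card_filter_not (s := Finset.univ)
    (fun x : Fin ℓ → ZMod 2 => ∑ j, u j * x j = 1)
  rw [← hcard, Finset.card_univ] at h
  simp only [Fintype.card_pi, ZMod.card, Finset.prod_const, Finset.card_univ,
    Fintype.card_fin] at h
  omega

theorem two_pow_mul_pow_le_two {ℓ m : ℕ} {ε : ℝ} (hε0 : 0 < ε) (hε1 : ε < 1)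
    (hm : ((ℓ : ℝ) - 1) / Real.logb 2 (1 / ε) ≤ (m : ℝ)) : (2 : ℝ) ^ ℓ * ε ^ m ≤ 2 := by
  have hlog : 0 < Real.logb 2 (1 / ε) :=
    Real.logb_pos one_lt_two (by rwa [lt_div_iff₀ hε0, one_mul])
  rw [div_le_iff₀ hlog, one_div, Real.logb_inv] at hm
  rw [← Real.logb_le_logb one_lt_two (by positivity) two_pos,
    Real.logb_mul (by positivity) (by positivity), Real.logb_pow, Real.logb_pow,
    Real.logb_self_eq_one one_lt_two]
  linarith

/-- `φ_{m,u}(X) ≥ 0` when `u` is not orthogonal to the left kernel of `X`. -/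
theorem phi_nonneg {ℓ n m : ℕ} {ε : ℝ} (hm : Even m) (hε : (2 : ℝ) ^ ℓ * ε ^ m ≤ 2)
    {X : Matrix (Fin ℓ) (Fin n) (ZMod 2)} {u v : Fin ℓ → ZMod 2}
    (hv : Matrix.vecMul v X = 0) (huv : ∑ j, u j * v j = 1) : 0 ≤ phi ℓ n ε m u X := by
  have hcard : (2 : ℝ) * (Finset.univ.filter
      fun x : Fin ℓ → ZMod 2 => ∑ j, u j * x j = 1).card = 2 ^ ℓ := by
    exact_mod_cast two_mul_card_filter_eq_one huv
  have hle : (n : ℝ) ^ m ≤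
      ∑ x ∈ Finset.univ.filter (fun x : Fin ℓ → ZMod 2 => ∑ j, u j * x j = 1),
        ((n : ℝ) - 2 * (wt (Matrix.vecMul x X) : ℝ)) ^ m := by
    have h := Finset.single_le_sum
      (f := fun x : Fin ℓ → ZMod 2 => ((n : ℝ) - 2 * (wt (Matrix.vecMul x X) : ℝ)) ^ m)
      (s := Finset.univ.filter fun x : Fin ℓ → ZMod 2 => ∑ j, u j * x j = 1)
      (fun x _ => hm.pow_nonneg _) (Finset.mem_filter.2 ⟨Finset.mem_univ v, huv⟩)
    simpa [hv, wt_zero] using h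
  have hnm : (0 : ℝ) ≤ (n : ℝ) ^ m := by positivity
  rw [phi, Finset.sum_sub_distrib, Finset.sum_const, nsmul_eq_mul, mul_pow]
  rw [← hcard] at hε
  nlinarith

/-- **Nonpositivity of `Φ_m` on nonzero balanced matrices** (Lemma 6.4(iii)). -/
theorem Phi_nonpos_of_ne_zero (ℓ n : ℕ) (hℓ : 0 < ℓ) (hn : 0 < n)
    (ε : ℝ) (hε0 : 0 < ε) (hε1 : ε < 1)
    (m : ℕ) (hmeven : Even m)
    (hm : ((ℓ : ℝ) - 1) / Real.logb 2 (1 / ε) ≤ (m : ℝ))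
    (X : Matrix (Fin ℓ) (Fin n) (ZMod 2)) (hX : X ∈ ValidEps ℓ n ε) (hX0 : X ≠ 0) :
    Phi ℓ n ε m X ≤ 0 := by
  classical
  have key : ∀ a : ZMod 2, a ≠ 0 → a = 1 := by decide
  have hε := two_pow_mul_pow_le_two hε0 hε1 hm
  obtain ⟨i, k, hik⟩ : ∃ i k, X i k ≠ 0 := by
    by_contra! h
    exact hX0 (Matrix.ext h)
  set W : Finset (Fin ℓ → ZMod 2) :=
    Finset.univ.filter fun u => ∀ v, Matrix.vecMul v X = 0 → ∑ j, u j * v j = 0 with hW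
  have hcol : (fun j => X j k) ∈ W := by
    refine Finset.mem_filter.2 ⟨Finset.mem_univ _, fun v hv => ?_⟩
    simpa [Matrix.vecMul, dotProduct, mul_comm] using congrFun hv k
  have hWeven : Even W.card := by
    refine even_card_of_add_mem W (w := fun j => X j k) (fun h => hik (congrFun h i)) ?_
    intro u hu
    refine Finset.mem_filter.2 ⟨Finset.mem_univ _, fun v hv => ?_⟩
    simp only [Pi.add_apply, add_mul, Finset.sum_add_distrib]
    rw [(Finset.mem_filter.1 hu).2 v hv, (Finset.mem_filter.1 hcol).2 v hv, add_zero]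
  have h0 : (0 : Fin ℓ → ZMod 2) ∈ W := by simp [hW]
  have hodd : Odd (W.erase 0).card := by
    rw [Finset.card_erase_of_mem h0]
    exact Nat.Even.sub_odd (Finset.card_pos.2 ⟨0, h0⟩) hWeven odd_one
  rw [Phi, ← Finset.prod_filter_mul_prod_filter_not _ (· ∈ W)]
  refine mul_nonpos_of_nonpos_of_nonneg (prod_nonpos_of_odd_card ?_ fun u hu => ?_)
    (Finset.prod_nonneg fun u hu => ?_)
  · convert hodd using 2
    ext u
    simp
  · exact phi_nonpos hmeven hX (Finset.mem_filter.1 (Finset.mem_filter.1 hu).2).2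
  · have huW := (Finset.mem_filter.1 hu).2
    simp only [hW, Finset.mem_filter, Finset.mem_univ, true_and, not_forall] at huW
    obtain ⟨v, hv, huv⟩ := huW
    exact phi_nonneg hmeven hε hv (key _ huv)
end
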